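/- Let (τ_n)_{n≥1} be a sequence of ⋆-automorphisms of M and τ a ⋆-automorphism of M, all preserving φ: φ(τ_n(x)) = φ(x) = φ(τ(x)) for all x ∈ M and n. Then there exist unique unitary operators v_n and v on H with v_n(xζ) = τ_n(x)ζ and v(xζ) = τ(x)ζ for all x ∈ M, and the following are equivalent: (i) for all f, g ∈ H, sup_{x ∈ M, ‖x‖ ≤ 1} |⟨f, (τ_n(x) − τ(x)) g⟩| → 0 as n → ∞; (ii) v_n f → v f in norm for every f ∈ H. -/

import Mathlib

open scoped ComplexOrder
open Filter Topology

noncomputable section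

local notation "⟪" x ", " y "⟫" => @inner ℂ _ _ x y

variable {H : Type*} [NormedAddCommGroup H] [InnerProductSpace ℂ H] [CompleteSpace H]

/-- `ζ` is a cyclic vector for the von Neumann algebra `M`. -/
def IsCyclicVector (M : VonNeumannAlgebra H) (ζ : H) : Prop :=
  Dense (Submodule.span ℂ {v : H | ∃ x ∈ M, v = x ζ} : Set H)

/-- `ζ` is a separating vector for the von Neumann algebra `M`. -/
def IsSeparatingVector (M : VonNeumannAlgebra H) (ζ : H) : Prop :=
  ∀ x ∈ M, x ζ = 0 → x = 0

/-- `τ` maps `M` into `M` and takes positive elements of `M` to positive operators. -/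
def IsPositiveMapOn (M : VonNeumannAlgebra H)
    (τ : (H →L[ℂ] H) →ₗ[ℂ] (H →L[ℂ] H)) : Prop :=
  (∀ x ∈ M, τ x ∈ M) ∧ ∀ x ∈ M, x.IsPositive → (τ x).IsPositive

/-- Membership in `P^{1/2}_φ(M)` where `φ = ⟨ζ, · ζ⟩`: a positive map on `M` with
`τ(1) ≤ 1`, `φ ∘ τ ≤ φ` on positive elements, and `‖τ(x)ζ‖ ≤ ‖xζ‖`. -/
def MemPHalf (M : VonNeumannAlgebra H) (ζ : H)
    (τ : (H →L[ℂ] H) →ₗ[ℂ] (H →L[ℂ] H)) : Prop :=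
  IsPositiveMapOn M τ ∧ ((1 : H →L[ℂ] H) - τ 1).IsPositive ∧
    (∀ x ∈ M, x.IsPositive → ⟪ζ, τ x ζ⟫ ≤ ⟪ζ, x ζ⟫) ∧
    ∀ x ∈ M, ‖τ x ζ‖ ≤ ‖x ζ‖

/-- `τ` restricts to a ⋆-automorphism of `M`: a bijection of `M` onto itself
preserving products and adjoints. -/
def IsStarAutomorphismOn (M : VonNeumannAlgebra H)
    (τ : (H →L[ℂ] H) →ₗ[ℂ] (H →L[ℂ] H)) : Prop :=
  Set.BijOn τ (M : Set (H →L[ℂ] H)) (M : Set (H →L[ℂ] H)) ∧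
    (∀ x ∈ M, ∀ y ∈ M, τ (x * y) = τ x * τ y) ∧
    ∀ x ∈ M, τ (star x) = star (τ x)

/-- The linear map `x ↦ x ζ` on the von Neumann algebra `M`. -/
def orbitMap (M : VonNeumannAlgebra H) (ζ : H) :
    Subalgebra.toSubmodule M.toStarSubalgebra.toSubalgebra →ₗ[ℂ] H where
  toFun x := (x : H →L[ℂ] H) ζ
  map_add' _ _ := rfl
  map_smul' _ _ := rfl

theorem IsCyclicVector.denseRange_orbitMap {M : VonNeumannAlgebra H} {ζ : H}
    (hcyc : IsCyclicVector M ζ) : DenseRange (orbitMap M ζ) := by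
  refine hcyc.mono ?_
  rw [← LinearMap.coe_range, SetLike.coe_subset_coe, Submodule.span_le]
  rintro _ ⟨x, hx, rfl⟩
  exact ⟨⟨x, hx⟩, rfl⟩

theorem IsCyclicVector.continuousLinearMap_ext {M : VonNeumannAlgebra H} {ζ : H}
    (hcyc : IsCyclicVector M ζ) {v w : H →L[ℂ] H} (h : ∀ x ∈ M, v (x ζ) = w (x ζ)) : v = w :=
  DFunLike.coe_injective <| hcyc.denseRange_orbitMap.equalizer v.continuous w.continuous <|
    funext fun x => h x x.2

theorem IsStarAutomorphismOn.norm_apply_vector {M : VonNeumannAlgebra H} {ζ : H}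
    {τ : (H →L[ℂ] H) →ₗ[ℂ] (H →L[ℂ] H)} (hτ : IsStarAutomorphismOn M τ)
    (hinv : ∀ x ∈ M, ⟪ζ, τ x ζ⟫ = ⟪ζ, x ζ⟫) {x : H →L[ℂ] H} (hx : x ∈ M) :
    ‖τ x ζ‖ = ‖x ζ‖ := by
  have key : ∀ y : H →L[ℂ] H, ⟪ζ, (star y * y) ζ⟫ = ⟪y ζ, y ζ⟫ := fun y => by
    rw [mul_apply_eq_comp, ContinuousLinearMap.star_eq_adjoint,
      ContinuousLinearMap.adjoint_inner_right]
  have h : ⟪τ x ζ, τ x ζ⟫ = ⟪x ζ, x ζ⟫ := by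
    rw [← key, ← key, ← hτ.2.2 x hx, ← hτ.2.1 _ (star_mem hx) x hx,
      hinv _ (mul_mem (star_mem hx) hx)]
  rw [@norm_eq_sqrt_re_inner ℂ, h, ← @norm_eq_sqrt_re_inner ℂ]

theorem IsStarAutomorphismOn.existsUnique_unitary {M : VonNeumannAlgebra H} {ζ : H}
    (hcyc : IsCyclicVector M ζ) {τ : (H →L[ℂ] H) →ₗ[ℂ] (H →L[ℂ] H)}
    (hτ : IsStarAutomorphismOn M τ) (hinv : ∀ x ∈ M, ⟪ζ, τ x ζ⟫ = ⟪ζ, x ζ⟫) :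
    ∃! v : H →L[ℂ] H, v ∈ unitary (H →L[ℂ] H) ∧ ∀ x ∈ M, v (x ζ) = τ x ζ := by
  let S := Subalgebra.toSubmodule M.toStarSubalgebra.toSubalgebra
  let e : S ≃ₗ[ℂ] S := LinearEquiv.ofBijective
    (τ.restrict (p := S) (q := S) fun x hx => hτ.1.mapsTo hx)
    ⟨fun x y hxy => Subtype.ext (hτ.1.injOn x.2 y.2 (congrArg Subtype.val hxy)),
      fun y => by
        obtain ⟨x, hx, hxy⟩ := hτ.1.surjOn y.2
        exact ⟨⟨x, hx⟩, Subtype.ext hxy⟩⟩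
  have hnorm : ∀ x, ‖orbitMap M ζ (e x)‖ = ‖orbitMap M ζ x‖ :=
    fun x => hτ.norm_apply_vector hinv x.2
  let V : H ≃ₗᵢ[ℂ] H := e.extendOfIsometry (orbitMap M ζ) (orbitMap M ζ)
    hcyc.denseRange_orbitMap hcyc.denseRange_orbitMap hnorm
  refine ⟨(Unitary.linearIsometryEquiv.symm V : H →L[ℂ] H), ⟨SetLike.coe_mem _, fun x hx => ?_⟩,
    fun w hw => hcyc.continuousLinearMap_ext fun x hx => ?_⟩
  · exact e.extendOfIsometry_eq (orbitMap M ζ) (orbitMap M ζ) hcyc.denseRange_orbitMap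
      hcyc.denseRange_orbitMap hnorm ⟨x, hx⟩
  · rw [hw.2 x hx]
    exact (e.extendOfIsometry_eq (orbitMap M ζ) (orbitMap M ζ) hcyc.denseRange_orbitMap
      hcyc.denseRange_orbitMap hnorm ⟨x, hx⟩).symm

/-- A ⋆-automorphism is implemented by the unitary it induces. -/
theorem IsStarAutomorphismOn.eq_conj {M : VonNeumannAlgebra H} {ζ : H}
    (hcyc : IsCyclicVector M ζ) {τ : (H →L[ℂ] H) →ₗ[ℂ] (H →L[ℂ] H)}
    (hτ : IsStarAutomorphismOn M τ) {v : H →L[ℂ] H} (hv : v ∈ unitary (H →L[ℂ] H))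
    (hvτ : ∀ x ∈ M, v (x ζ) = τ x ζ) {x : H →L[ℂ] H} (hx : x ∈ M) :
    τ x = v * x * star v := by
  have h : τ x * v = v * x := hcyc.continuousLinearMap_ext fun y hy => by
    have h1 := hvτ (x * y) (mul_mem hx hy)
    rw [hτ.2.1 x hx y hy] at h1
    simp only [mul_apply_eq_comp] at h1 ⊢
    rw [h1, hvτ y hy]
  rw [← h, mul_assoc, Unitary.mul_star_self_of_mem hv, mul_one]

theorem tendsto_star_apply_of_mem_unitary {ι : Type*} {l : Filter ι} {vn : ι → H →L[ℂ] H}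
    {v : H →L[ℂ] H} (hvn : ∀ n, vn n ∈ unitary (H →L[ℂ] H)) (hv : v ∈ unitary (H →L[ℂ] H))
    (h : ∀ f, Tendsto (fun n => vn n f) l (𝓝 (v f))) (f : H) :
    Tendsto (fun n => star (vn n) f) l (𝓝 (star v f)) := by
  have hf := h (star v f)
  rw [tendsto_iff_norm_sub_tendsto_zero] at hf ⊢
  refine hf.congr fun n => ?_
  have h1 : v (star v f) = f := by
    rw [← mul_apply_eq_comp, Unitary.mul_star_self_of_mem hv,
      one_apply_eq_self]
  have h2 : vn n (star (vn n) f) = f := by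
    rw [← mul_apply_eq_comp, Unitary.mul_star_self_of_mem (hvn n),
      one_apply_eq_self]
  rw [h1, ← ContinuousLinearMap.norm_map_of_mem_unitary (hvn n) (star (vn n) f - star v f),
    map_sub, h2, norm_sub_rev]

theorem norm_inner_conj_sub_conj_le (v w x : H →L[ℂ] H) (f g : H) :
    ‖⟪f, (v * x * star v - w * x * star w) g⟫‖ ≤
      ‖x‖ * (‖star v f - star w f‖ * ‖star v g‖ + ‖star w f‖ * ‖star v g - star w g‖) := by
  have conj : ∀ u : H →L[ℂ] H, ⟪f, (u * x * star u) g⟫ = ⟪star u f, x (star u g)⟫ := fun u => by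
    rw [ContinuousLinearMap.star_eq_adjoint, ContinuousLinearMap.adjoint_inner_left]
    rfl
  have split : ⟪f, (v * x * star v - w * x * star w) g⟫ =
      ⟪star v f - star w f, x (star v g)⟫ + ⟪star w f, x (star v g - star w g)⟫ := by
    rw [sub_apply, inner_sub_right, conj, conj, map_sub, inner_sub_left,
      inner_sub_right]
    ring
  rw [split]
  calc _ ≤ ‖star v f - star w f‖ * (‖x‖ * ‖star v g‖)
        + ‖star w f‖ * (‖x‖ * ‖star v g - star w g‖) := by
        refine (norm_add_le _ _).trans (add_le_add ?_ ?_) <;>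
          refine (norm_inner_le_norm _ _).trans ?_ <;> gcongr <;> exact x.le_opNorm _
    _ = _ := by ring

/-- Weak convergence together with convergence of norms gives norm convergence. -/
theorem tendsto_of_tendsto_inner_of_norm_eq {ι : Type*} {l : Filter ι} {u : ι → H} {w : H}
    (hnorm : ∀ n, ‖u n‖ = ‖w‖) (h : Tendsto (fun n => ⟪w, u n - w⟫) l (𝓝 0)) :
    Tendsto u l (𝓝 w) := by
  have hsq : ∀ n, ‖u n - w‖ ^ 2 = -2 * (⟪w, u n - w⟫).re := fun n => by
    have h1 := @norm_add_sq ℂ _ _ _ _ w (u n - w)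
    have h2 : RCLike.re ⟪w, u n - w⟫ = (⟪w, u n - w⟫).re := rfl
    rw [add_sub_cancel, hnorm n, h2] at h1
    linarith
  have h0 : Tendsto (fun n => ‖u n - w‖ ^ 2) l (𝓝 0) := by
    simp_rw [hsq]
    simpa using ((Complex.continuous_re.tendsto 0).comp h).const_mul (-2)
  rw [tendsto_iff_norm_sub_tendsto_zero]
  simpa using h0.sqrt

theorem tendsto_apply_of_denseRange_of_mem_unitary {ι α : Type*} {l : Filter ι}
    {vn : ι → H →L[ℂ] H} {v : H →L[ℂ] H} (hvn : ∀ n, vn n ∈ unitary (H →L[ℂ] H))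
    (hv : v ∈ unitary (H →L[ℂ] H)) {d : α → H} (hd : DenseRange d)
    (h : ∀ a, Tendsto (fun n => vn n (d a)) l (𝓝 (v (d a)))) (f : H) :
    Tendsto (fun n => vn n f) l (𝓝 (v f)) := by
  rw [Metric.tendsto_nhds]
  intro ε hε
  obtain ⟨a, ha⟩ := hd.exists_dist_lt f (by positivity : 0 < ε / 3)
  filter_upwards [Metric.tendsto_nhds.1 (h a) (ε / 3) (by positivity)] with n hn
  have dist_map : ∀ {u : H →L[ℂ] H}, u ∈ unitary (H →L[ℂ] H) → ∀ p q, dist (u p) (u q) = dist p q :=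
    fun hu p q => by
      rw [dist_eq_norm, ← map_sub, ContinuousLinearMap.norm_map_of_mem_unitary hu, dist_eq_norm]
  have h4 := dist_triangle4 (vn n f) (vn n (d a)) (v (d a)) (v f)
  rw [dist_map (hvn n), dist_map hv, dist_comm (d a) f] at h4
  linarith

theorem stmt14 (M : VonNeumannAlgebra H) (ζ : H) (hζ : ‖ζ‖ = 1)
    (hcyc : IsCyclicVector M ζ) (hsep : IsSeparatingVector M ζ)
    (τn : ℕ → (H →L[ℂ] H) →ₗ[ℂ] (H →L[ℂ] H)) (τ : (H →L[ℂ] H) →ₗ[ℂ] (H →L[ℂ] H))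
    (hτn : ∀ n, IsStarAutomorphismOn M (τn n)) (hτ : IsStarAutomorphismOn M τ)
    (hinvn : ∀ n, ∀ x ∈ M, ⟪ζ, τn n x ζ⟫ = ⟪ζ, x ζ⟫)
    (hinv : ∀ x ∈ M, ⟪ζ, τ x ζ⟫ = ⟪ζ, x ζ⟫) :
    (∀ n, ∃! v : H →L[ℂ] H, v ∈ unitary (H →L[ℂ] H) ∧ ∀ x ∈ M, v (x ζ) = τn n x ζ) ∧
    (∃! v : H →L[ℂ] H, v ∈ unitary (H →L[ℂ] H) ∧ ∀ x ∈ M, v (x ζ) = τ x ζ) ∧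
    ∀ vn : ℕ → H →L[ℂ] H, ∀ v : H →L[ℂ] H,
      (∀ n, vn n ∈ unitary (H →L[ℂ] H) ∧ ∀ x ∈ M, vn n (x ζ) = τn n x ζ) →
      (v ∈ unitary (H →L[ℂ] H) ∧ ∀ x ∈ M, v (x ζ) = τ x ζ) →
      ((∀ f g : H, ∀ ε > (0 : ℝ), ∃ N : ℕ, ∀ n ≥ N, ∀ x ∈ M, ‖x‖ ≤ 1 →
          ‖⟪f, (τn n x - τ x) g⟫‖ < ε) ↔
        ∀ f : H, Tendsto (fun n => vn n f) atTop (𝓝 (v f))) := by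
  refine ⟨fun n => (hτn n).existsUnique_unitary hcyc (hinvn n),
    hτ.existsUnique_unitary hcyc hinv, fun vn v hvn hv => ⟨fun hi => ?_, fun hii f g ε hε => ?_⟩⟩
  · refine tendsto_apply_of_denseRange_of_mem_unitary (fun n => (hvn n).1) hv.1
      hcyc.denseRange_orbitMap fun x => ?_
    obtain ⟨x, hx : x ∈ M⟩ := x
    change Tendsto (fun n => vn n (x ζ)) atTop (𝓝 (v (x ζ)))
    refine tendsto_of_tendsto_inner_of_norm_eq (fun n => ?_) ?_
    · rw [ContinuousLinearMap.norm_map_of_mem_unitary (hvn n).1,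
        ContinuousLinearMap.norm_map_of_mem_unitary hv.1]
    · rw [Metric.tendsto_atTop]
      intro ε hε
      have hc : 0 < ‖x‖ + 1 := by positivity
      obtain ⟨N, hN⟩ := hi (v (x ζ)) ζ (ε / (‖x‖ + 1)) (by positivity)
      refine ⟨N, fun n hn => ?_⟩
      have hy : ((‖x‖ + 1 : ℝ) : ℂ)⁻¹ • x ∈ M := M.toStarSubalgebra.smul_mem hx _
      have hcn : ‖((‖x‖ + 1 : ℝ) : ℂ)⁻¹‖ = (‖x‖ + 1)⁻¹ := by
        rw [norm_inv, Complex.norm_real, Real.norm_of_nonneg hc.le]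
      have hy1 : ‖((‖x‖ + 1 : ℝ) : ℂ)⁻¹ • x‖ ≤ 1 := by
        rw [norm_smul, hcn, inv_mul_le_iff₀ hc]
        linarith
      have h := hN n hn _ hy hy1
      rw [map_smul, map_smul, ← smul_sub, smul_apply, inner_smul_right,
        norm_mul, hcn, inv_mul_lt_iff₀ hc, mul_div_cancel₀ _ hc.ne'] at h
      rwa [dist_zero_right, (hvn n).2 x hx, show v (x ζ) = τ x ζ from hv.2 x hx,
        ← sub_apply, ← hv.2 x hx]
  · have hstar := tendsto_star_apply_of_mem_unitary (fun n => (hvn n).1) hv.1 hii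
    have hlim : Tendsto (fun n => ‖star (vn n) f - star v f‖ * ‖star (vn n) g‖
        + ‖star v f‖ * ‖star (vn n) g - star v g‖) atTop (𝓝 0) := by
      simpa using ((tendsto_iff_norm_sub_tendsto_zero.1 (hstar f)).mul (hstar g).norm).add
        ((tendsto_iff_norm_sub_tendsto_zero.1 (hstar g)).const_mul ‖star v f‖)
    obtain ⟨N, hN⟩ := eventually_atTop.1 (hlim.eventually_lt_const hε)
    refine ⟨N, fun n hn x hx hx1 => ?_⟩
    rw [(hτn n).eq_conj hcyc (hvn n).1 (hvn n).2 hx, hτ.eq_conj hcyc hv.1 hv.2 hx]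
    refine (norm_inner_conj_sub_conj_le _ _ _ _ _).trans_lt (lt_of_le_of_lt ?_ (hN n hn))
    exact mul_le_of_le_one_left (by positivity) hx1
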